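/- For h ∈ F_q, define S_h = Σ_{y ∈ F_q} ψ(h·y³). Then S_g, S_{g²}, and S_{g³} are the three roots of the cubic equation x³ − 3qx − qc = 0; that is, x³ − 3qx − qc = (x − S_g)(x − S_{g²})(x − S_{g³}) as polynomials over ℂ. -/

import Mathlib

theorem Int.prime_dvd_of_dvd_sq_add_mul_add_seven_mul_sq {p : ℕ} [Fact p.Prime] (hp : p % 3 = 2)
    {e d : ℤ} (h : (p : ℤ) ∣ e ^ 2 + e * d + 7 * d ^ 2) : (p : ℤ) ∣ e ∧ (p : ℤ) ∣ d := by
  have h3 : (3 : ZMod p) ≠ 0 := by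
    intro h0
    have : ((3 : ℕ) : ZMod p) = 0 := by exact_mod_cast h0
    rw [ZMod.natCast_eq_zero_iff, Nat.prime_dvd_prime_iff_eq Fact.out Nat.prime_three] at this
    omega
  simp only [← ZMod.intCast_zmod_eq_zero_iff_dvd] at h ⊢
  push_cast at h
  have hd : (d : ZMod p) = 0 := by
    by_contra hd
    obtain ⟨w, hw⟩ : ∃ w : ZMod p, (e : ZMod p) = (1 + 3 * w) * d :=
      ⟨((e : ZMod p) / d - 1) / 3, by field_simp; ring⟩
    rw [hw] at h
    have hw1 : w ^ 2 + w + 1 = 0 := by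
      have : 9 * (d : ZMod p) ^ 2 * (w ^ 2 + w + 1) = 0 := by linear_combination h
      have h9 : (9 : ZMod p) * (d : ZMod p) ^ 2 ≠ 0 := by
        have : (9 : ZMod p) = 3 ^ 2 := by norm_num
        rw [this]; positivity
      exact (mul_eq_zero.mp this).resolve_left h9
    have hw3 : w ^ 3 = 1 := by linear_combination (w - 1) * hw1
    have hw0 : w ≠ 0 := by rintro rfl; simp at hw3
    have hf := ZMod.pow_card_sub_one_eq_one hw0
    have hp1 : p - 1 = 3 * (p / 3) + 1 := by omega
    rw [hp1, pow_add, pow_mul, hw3, one_pow, one_mul, pow_one] at hf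
    rw [hf] at hw1
    exact h3 (by linear_combination hw1)
  refine ⟨?_, hd⟩
  rw [hd] at h
  simpa using h

theorem Int.eq_zero_of_sq_add_mul_add_seven_mul_sq_eq_pow {p : ℕ} [Fact p.Prime] (hp : p % 3 = 2)
    (n : ℕ) (e d : ℤ) (h : e ^ 2 + e * d + 7 * d ^ 2 = (p : ℤ) ^ n) : d = 0 := by
  have hp0 : (p : ℤ) ≠ 0 := by exact_mod_cast (Fact.out : p.Prime).ne_zero
  induction n using Nat.strong_induction_on generalizing e d with
  | _ n ih =>
    rcases n with _ | n
    · by_contra hd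
      have : 1 ≤ d ^ 2 := by have := sq_nonneg d; have := pow_ne_zero 2 hd; omega
      nlinarith [sq_nonneg (2 * e + d)]
    · obtain ⟨⟨e, rfl⟩, ⟨d, rfl⟩⟩ :=
        Int.prime_dvd_of_dvd_sq_add_mul_add_seven_mul_sq hp (h ▸ dvd_pow_self _ n.succ_ne_zero)
      have h1 : (p : ℤ) * (e ^ 2 + e * d + 7 * d ^ 2) = p ^ n :=
        mul_left_cancel₀ hp0 (by rw [← pow_succ']; linear_combination h)
      rcases n with _ | n
      · have : (p : ℤ) ∣ 1 := ⟨_, by simpa using h1.symm⟩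
        exact absurd this (Nat.prime_iff_prime_int.mp Fact.out).not_dvd_one
      · have h2 := mul_left_cancel₀ hp0 (h1.trans (pow_succ' _ n))
        rw [ih n (by omega) e d h2, mul_zero]

theorem Int.eq_of_four_mul_pow_eq_of_mod_three_eq_two {p : ℕ} [Fact p.Prime] (hp : p % 3 = 2)
    {n : ℕ} {c d a b : ℤ} (hcd : 4 * (p : ℤ) ^ n = c ^ 2 + 27 * d ^ 2)
    (hab : 4 * (p : ℤ) ^ n = a ^ 2 + 27 * b ^ 2) (hc : c % 3 = 1) (ha : a % 3 = 1) : c = a := by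
  have key : ∀ c d : ℤ, 4 * (p : ℤ) ^ n = c ^ 2 + 27 * d ^ 2 → d = 0 := by
    intro c d h
    obtain ⟨e, rfl⟩ : ∃ e, c = d + 2 * e := by
      have h2 : (2 : ℤ) ∣ (c - d) := by
        have : Even ((c - d) * (c - d)) := ⟨2 * p ^ n - 14 * d ^ 2 - c * d + d ^ 2, by linarith⟩
        rcases Int.even_mul.mp this with h | h <;> exact h.two_dvd
      obtain ⟨e, he⟩ := h2
      exact ⟨e, by omega⟩
    exact Int.eq_zero_of_sq_add_mul_add_seven_mul_sq_eq_pow hp n e d (by linarith)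
  have h1 := key c d hcd
  have h2 := key a b hab
  subst h1 h2
  rcases sq_eq_sq_iff_eq_or_eq_neg.mp (by linarith : c ^ 2 = a ^ 2) with h | h <;> omega

theorem Int.eq_of_four_mul_pow_eq_of_not_dvd {p : ℕ} [Fact p.Prime] (hp2 : p ≠ 2)
    {n : ℕ} {c d a b : ℤ} (hcd : 4 * (p : ℤ) ^ n = c ^ 2 + 27 * d ^ 2)
    (hab : 4 * (p : ℤ) ^ n = a ^ 2 + 27 * b ^ 2) (hc : c % 3 = 1) (ha : a % 3 = 1)
    (hpc : ¬ (p : ℤ) ∣ c) (hpa : ¬ (p : ℤ) ∣ a) : c = a := by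
  have hp : Prime (p : ℤ) := Nat.prime_iff_prime_int.mp Fact.out
  rcases n with _ | n
  · have hb : b = 0 := by
      by_contra hb
      have := sq_nonneg b; have := pow_ne_zero 2 hb; have := sq_nonneg a
      simp at hab; omega
    have hd : d = 0 := by
      by_contra hb
      have := sq_nonneg d; have := pow_ne_zero 2 hb; have := sq_nonneg c
      simp at hcd; omega
    subst hb hd
    rcases sq_eq_sq_iff_eq_or_eq_neg.mp (by linarith : c ^ 2 = a ^ 2) with h | h <;> omega
  have hpb : ¬ (p : ℤ) ∣ b := by
    rintro ⟨b, rfl⟩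
    exact hpa (hp.dvd_of_dvd_pow (n := 2)
      ⟨4 * p ^ n - 27 * p * b ^ 2, by rw [pow_succ] at hab; linarith⟩)
  have hnd : ¬ (p : ℤ) ∣ 2 := by
    intro h
    have : p ∣ 2 := by exact_mod_cast h
    exact hp2 ((Nat.prime_dvd_prime_iff_eq Fact.out Nat.prime_two).mp this)
  have finish : ∀ d : ℤ, 4 * (p : ℤ) ^ (n + 1) = c ^ 2 + 27 * d ^ 2 →
      (p : ℤ) ^ (n + 1) ∣ c * b - a * d → c = a := by
    rintro d hcd ⟨t, ht⟩
    have hQ : 0 < (p : ℤ) ^ (n + 1) := pow_pos (by exact_mod_cast (Fact.out : p.Prime).pos) _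
    generalize (p : ℤ) ^ (n + 1) = Q at *
    have hid : (c * a + 27 * b * d) ^ 2 + 27 * (c * b - a * d) ^ 2 = 16 * Q ^ 2 := by
      linear_combination (-4 * Q) * hcd - (c ^ 2 + 27 * d ^ 2) * hab
    have ht0 : t = 0 := by
      by_contra h0
      have h1 : 1 ≤ t ^ 2 := by have := sq_nonneg t; have := pow_ne_zero 2 h0; omega
      rw [ht] at hid
      nlinarith [sq_nonneg (c * a + 27 * b * d), pow_pos hQ 2]
    rw [ht0, mul_zero] at ht
    have : Q * c ^ 2 = Q * a ^ 2 := by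
      have : 4 * (Q * c ^ 2) = 4 * (Q * a ^ 2) := by
        linear_combination c ^ 2 * hab - a ^ 2 * hcd + 27 * (c * b + a * d) * ht
      linarith
    rcases sq_eq_sq_iff_eq_or_eq_neg.mp (mul_left_cancel₀ hQ.ne' this) with h | h <;> omega
  have hprod : (p : ℤ) ^ (n + 1) ∣ (c * b - a * d) * (c * b + a * d) :=
    ⟨4 * (b ^ 2 - d ^ 2), by linear_combination (d ^ 2) * hab - b ^ 2 * hcd⟩
  by_cases h1 : (p : ℤ) ∣ c * b - a * d
  · have h2 : ¬ (p : ℤ) ∣ c * b + a * d := by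
      intro h2
      have h3 := dvd_add h1 h2
      rw [show c * b - a * d + (c * b + a * d) = 2 * (c * b) by ring] at h3
      rcases hp.dvd_or_dvd h3 with h | h
      · exact hnd h
      · exact (hp.dvd_or_dvd h).elim hpc hpb
    exact finish d hcd (hp.pow_dvd_of_dvd_mul_right _ h2 hprod)
  · refine finish (-d) (by linarith) ?_
    rw [show c * b - a * -d = c * b + a * d by ring]
    exact hp.pow_dvd_of_dvd_mul_left _ h1 hprod

theorem Nat.not_dvd_choose_two_mul_of_three_mul_add_one_eq_pow {p : ℕ} [Fact p.Prime]
    (hp : p % 3 = 1) (k m : ℕ) (h : 3 * m + 1 = p ^ k) : ¬ p ∣ (2 * m).choose m := by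
  have hpp : p.Prime := Fact.out
  induction k generalizing m with
  | zero =>
    obtain rfl : m = 0 := by simpa using h
    simpa using hpp.one_lt.ne'
  | succ k ih =>
    have hk : p ^ k % 3 = 1 := by rw [Nat.pow_mod, hp]; simp
    set l := p ^ k / 3
    set r := p / 3
    have hl : 3 * l + 1 = p ^ k := by omega
    have hr : 3 * r + 1 = p := by omega
    have hm : m = r + p * l := by
      rw [pow_succ', ← hl] at h
      have : p * (3 * l + 1) = 3 * (p * l) + p := by ring
      omega
    have h2m : 2 * m = 2 * r + p * (2 * l) := by rw [hm]; ring
    have hmod := Choose.choose_modEq_choose_mod_mul_choose_div_nat (n := 2 * m) (k := m) (p := p)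
    rw [h2m, hm, Nat.add_mul_mod_self_left, Nat.add_mul_mod_self_left,
      Nat.add_mul_div_left _ _ hpp.pos, Nat.add_mul_div_left _ _ hpp.pos,
      Nat.mod_eq_of_lt (by omega : 2 * r < p), Nat.mod_eq_of_lt (by omega : r < p),
      Nat.div_eq_of_lt (by omega : 2 * r < p), Nat.div_eq_of_lt (by omega : r < p),
      zero_add, zero_add] at hmod
    rw [h2m, hm, (hmod.dvd_iff dvd_rfl), hpp.dvd_mul]
    rintro (h' | h')
    · have h2 := h'.trans ((Nat.choose_mul_factorial_mul_factorial
        (by omega : r ≤ 2 * r)) ▸ (dvd_mul_right _ _ |>.trans (dvd_mul_right _ _)))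
      rw [hpp.dvd_factorial] at h2
      omega
    · exact ih l hl h'

theorem exists_int_forall_sum_pow_eq {α : Type*} (s : Finset α) (n : α → ℕ) :
    ∃ u v : ℤ, ∀ (R : Type) [CommRing R] (ω : R), ω ^ 2 + ω + 1 = 0 →
      ∑ x ∈ s, ω ^ n x = u + v * ω := by
  have pow_eq : ∀ k : ℕ, ∃ u v : ℤ, ∀ (R : Type) [CommRing R] (ω : R), ω ^ 2 + ω + 1 = 0 →
      ω ^ k = u + v * ω := by
    intro k
    induction k with
    | zero => exact ⟨1, 0, fun R _ ω _ => by simp⟩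
    | succ k ih =>
      obtain ⟨u, v, h⟩ := ih
      refine ⟨-v, u - v, fun R _ ω hω => ?_⟩
      rw [pow_succ, h R ω hω]
      push_cast
      linear_combination (v : R) * hω
  choose u v h using pow_eq
  refine ⟨∑ x ∈ s, u (n x), ∑ x ∈ s, v (n x), fun R _ ω hω => ?_⟩
  push_cast
  rw [Finset.sum_mul, ← Finset.sum_add_distrib]
  exact Finset.sum_congr rfl fun x _ => h _ R ω hω

theorem exists_int_eq_add_mul_of_mem_adjoin {R : Type*} [CommRing R] {ω : R}
    (hω : ω ^ 2 + ω + 1 = 0) {z : R} (hz : z ∈ Algebra.adjoin ℤ {ω}) :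
    ∃ a b : ℤ, z = a + b * ω := by
  induction hz using Algebra.adjoin_induction with
  | mem x hx => exact ⟨0, 1, by simpa using hx⟩
  | algebraMap r => exact ⟨r, 0, by simp⟩
  | add x y _ _ hx hy =>
    obtain ⟨a, b, rfl⟩ := hx
    obtain ⟨c, d, rfl⟩ := hy
    exact ⟨a + c, b + d, by push_cast; ring⟩
  | mul x y _ _ hx hy =>
    obtain ⟨a, b, rfl⟩ := hx
    obtain ⟨c, d, rfl⟩ := hy
    exact ⟨a * c - b * d, a * d + b * c - b * d, by
      push_cast; linear_combination (b * d : R) * hω⟩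

theorem sq_add_self_add_one_eq_zero_of_pow_three_eq_one {R : Type*} [CommRing R] [IsDomain R]
    {x : R} (h : x ^ 3 = 1) (h1 : x ≠ 1) : x ^ 2 + x + 1 = 0 := by
  have : (x - 1) * (x ^ 2 + x + 1) = 0 := by linear_combination h
  exact (mul_eq_zero.mp this).resolve_left (sub_ne_zero.mpr h1)

theorem inv_eq_sq_of_orderOf_eq_three {G : Type*} [Group G] {x : G} (hx : orderOf x = 3) :
    x⁻¹ = x ^ 2 := by
  rw [inv_eq_iff_mul_eq_one, ← pow_succ']
  have h := pow_orderOf_eq_one x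
  rwa [hx] at h

theorem ne_one_of_orderOf_eq_three {G : Type*} [Group G] {x : G} (hx : orderOf x = 3) :
    x ≠ 1 := by
  rintro rfl
  rw [orderOf_one] at hx
  omega


theorem MulChar.apply_generator_sq_add_self_add_one {F : Type*} [Field F]
    {g : Fˣ} (hg : ∀ x : Fˣ, x ∈ Subgroup.zpowers g)
    {χ : MulChar F ℂ} (hχ : orderOf χ = 3) :
    χ g ^ 2 + χ g + 1 = 0 := by
  apply sq_add_self_add_one_eq_zero_of_pow_three_eq_one
  · rw [← MulChar.pow_apply_coe, ← hχ, pow_orderOf_eq_one, MulChar.one_apply_coe]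
  · intro h
    exact ne_one_of_orderOf_eq_three hχ
      ((MulChar.eq_iff hg χ 1).mpr (by rw [h, MulChar.one_apply_coe]))

section FiniteField

variable {F : Type} [Field F] [Fintype F]

theorem FiniteField.sum_pow_eq_ite {i : ℕ} (hi : i ≠ 0) :
    ∑ x : F, x ^ i = if Fintype.card F - 1 ∣ i then -1 else 0 := by
  classical
  rw [← FiniteField.sum_pow_units, ← Fintype.sum_subtype_add_sum_subtype (fun x : F => x ≠ 0)]
  have h0 : ∑ x : {x : F // ¬ x ≠ 0}, (x : F) ^ i = 0 :=
    Finset.sum_eq_zero fun x _ => by rw [not_not.mp x.2, zero_pow hi]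
  rw [h0, add_zero]
  exact (Fintype.sum_equiv (unitsEquivNeZero (G₀ := F)) _ _ fun x => rfl).symm

theorem FiniteField.sum_pow_mul_one_sub_pow (a : ℕ) :
    ∑ x : F, x ^ a * (1 - x) ^ a =
      ∑ j ∈ Finset.range (a + 1), (-1) ^ j * (a.choose j : F) * ∑ x : F, x ^ (a + j) := by
  simp_rw [Finset.mul_sum]
  rw [Finset.sum_comm]
  refine Finset.sum_congr rfl fun x _ => ?_
  rw [sub_eq_add_neg, add_comm, add_pow, Finset.mul_sum]
  refine Finset.sum_congr rfl fun j _ => ?_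
  rw [neg_pow, one_pow, pow_add]
  ring

theorem FiniteField.sum_pow_mul_one_sub_pow_eq_zero {m : ℕ} (hm : m ≠ 0)
    (hcard : Fintype.card F = 3 * m + 1) : ∑ x : F, x ^ m * (1 - x) ^ m = 0 := by
  rw [sum_pow_mul_one_sub_pow]
  refine Finset.sum_eq_zero fun j hj => ?_
  rw [Finset.mem_range] at hj
  rw [sum_pow_lt_card_sub_one F _ (by omega), mul_zero]

theorem FiniteField.sum_pow_two_mul_mul_one_sub_pow_two_mul {m : ℕ} (hm : m ≠ 0)
    (hcard : Fintype.card F = 3 * m + 1) :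
    ∑ x : F, x ^ (2 * m) * (1 - x) ^ (2 * m) = -((-1) ^ m * ((2 * m).choose m : F)) := by
  rw [sum_pow_mul_one_sub_pow, Finset.sum_eq_single m]
  · rw [sum_pow_eq_ite (by omega), if_pos ⟨1, by omega⟩]
    ring
  · intro j hj hjm
    rw [Finset.mem_range] at hj
    rw [sum_pow_eq_ite (by omega), if_neg, mul_zero]
    rintro ⟨t, ht⟩
    rw [hcard, Nat.add_sub_cancel] at ht
    have ht1 : t ≠ 1 := by rintro rfl; omega
    have ht0 : t ≠ 0 := by rintro rfl; omega
    have : 3 * m * 2 ≤ 3 * m * t := Nat.mul_le_mul_left _ (by omega)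
    omega
  · intro h
    exact absurd (Finset.mem_range.mpr (by omega)) h

theorem Units.exists_pow_eq_of_forall_mem_zpowers {g : Fˣ} (hg : ∀ x : Fˣ, x ∈ Subgroup.zpowers g)
    {x : F} (hx : x ≠ 0) : ∃ j : ℕ, x = (g : F) ^ j := by
  obtain ⟨j, hj⟩ := mem_powers_iff_mem_zpowers.mpr (hg (Units.mk0 x hx))
  exact ⟨j, by simpa using (congrArg Units.val hj).symm⟩

theorem Units.generator_pow_sq_add_self_add_one {g : Fˣ} (hg : ∀ x : Fˣ, x ∈ Subgroup.zpowers g)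
    {m : ℕ} (hm : m ≠ 0) (hcard : Fintype.card F = 3 * m + 1) :
    ((g : F) ^ m) ^ 2 + (g : F) ^ m + 1 = 0 := by
  have ho : orderOf g = 3 * m := by
    rw [orderOf_eq_card_of_forall_mem_zpowers hg, Nat.card_units, Nat.card_eq_fintype_card, hcard,
      Nat.add_sub_cancel]
  apply sq_add_self_add_one_eq_zero_of_pow_three_eq_one
  · rw [← pow_mul, mul_comm, ← ho]
    rw [← Units.val_pow_eq_pow_val, pow_orderOf_eq_one, Units.val_one]
  · intro h
    exact pow_ne_one_of_lt_orderOf (x := g) hm (by omega) (Units.ext (by simpa using h))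

theorem card_pow_three_eq {g : Fˣ} (hg : ∀ x : Fˣ, x ∈ Subgroup.zpowers g)
    {χ : MulChar F ℂ} (hχ : orderOf χ = 3) {m : ℕ} (hm : m ≠ 0) 
    (hcard : Fintype.card F = 3 * m + 1) [DecidableEq F] (x : F) :
    ((Finset.univ.filter fun y : F => y ^ 3 = x).card : ℂ) = 1 + χ x + χ⁻¹ x := by
  have hω := MulChar.apply_generator_sq_add_self_add_one hg hχ
  have hinv : ∀ x, χ⁻¹ x = χ x ^ 2 := by
    intro x
    rw [inv_eq_sq_of_orderOf_eq_three hχ, MulChar.pow_apply' χ two_ne_zero]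
  rw [hinv]
  rcases eq_or_ne x 0 with rfl | hx
  · simp [Finset.filter_eq', MulChar.map_zero]
  obtain ⟨j, rfl⟩ := Units.exists_pow_eq_of_forall_mem_zpowers hg hx
  have hζ := Units.generator_pow_sq_add_self_add_one hg hm hcard
  have hω3 : χ g ^ 3 = 1 := by linear_combination (χ g - 1) * hω
  by_cases hj : 3 ∣ j
  · obtain ⟨i, rfl⟩ := hj
    rw [map_pow, pow_mul (χ g), hω3, one_pow]
    set ζ := (g : F) ^ m
    set y := (g : F) ^ i with hy
    have hy0 : y ≠ 0 := pow_ne_zero _ g.ne_zero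
    have h3 : (3 : F) ≠ 0 := by
      intro h3
      have := FiniteField.cast_card_eq_zero F
      rw [hcard] at this
      push_cast at this
      rw [h3, zero_mul, zero_add] at this
      exact one_ne_zero this
    have hζ1 : ζ ≠ 1 := by
      intro h
      rw [h] at hζ
      exact h3 (by linear_combination hζ)
    have hζ0 : ζ ≠ 0 := pow_ne_zero _ g.ne_zero
    have hset : (Finset.univ.filter fun z : F => z ^ 3 = (g : F) ^ (3 * i)) =
        {y, ζ * y, ζ ^ 2 * y} := by
      ext z
      simp only [Finset.mem_filter, Finset.mem_univ, true_and, Finset.mem_insert,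
        Finset.mem_singleton]
      have hfac : z ^ 3 - (g : F) ^ (3 * i) = (z - y) * ((z - ζ * y) * (z - ζ ^ 2 * y)) := by
        rw [mul_comm 3 i, pow_mul, ← hy]
        linear_combination (z - y) * (y * z - (ζ - 1) * y ^ 2) * hζ
      rw [← sub_eq_zero, hfac, mul_eq_zero, mul_eq_zero, sub_eq_zero, sub_eq_zero, sub_eq_zero]
    have hcard3 : ({y, ζ * y, ζ ^ 2 * y} : Finset F).card = 3 := by
      refine Finset.card_eq_three.mpr ⟨_, _, _, ?_, ?_, ?_, rfl⟩
      · intro h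
        exact hζ1 (mul_right_cancel₀ hy0 (by rw [one_mul]; exact h.symm))
      · intro h
        have h2 : ζ ^ 2 = 1 := mul_right_cancel₀ hy0 (by rw [one_mul]; exact h.symm)
        exact hζ1 (by linear_combination (ζ - 1) * hζ - ζ * h2)
      · intro h
        have h2 := mul_right_cancel₀ hy0 h
        exact hζ1 (mul_left_cancel₀ hζ0 (by rw [mul_one, ← pow_two]; exact h2.symm))
    rw [hset, hcard3]
    norm_num
  · have hne : χ ((g : F) ^ j) ≠ 1 := by
      rw [map_pow]
      intro h
      apply hj
      have : orderOf (χ g) = 3 := orderOf_eq_prime hω3 (by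
        intro h
        rw [h] at hω
        norm_num at hω)
      exact this ▸ orderOf_dvd_of_pow_eq_one h
    have hempty : (Finset.univ.filter fun z : F => z ^ 3 = (g : F) ^ j) = ∅ := by
      refine Finset.filter_eq_empty_iff.mpr fun z _ hz => ?_
      rw [← hz] at hne
      have hz0 : z ≠ 0 := by
        rintro rfl
        exact pow_ne_zero j g.ne_zero (by simpa using hz.symm)
      obtain ⟨i, rfl⟩ := Units.exists_pow_eq_of_forall_mem_zpowers hg hz0
      exact hne (by rw [map_pow, map_pow, pow_right_comm, hω3, one_pow])
    rw [hempty]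
    have := sq_add_self_add_one_eq_zero_of_pow_three_eq_one
      (x := χ ((g : F) ^ j)) (by rw [map_pow, pow_right_comm, hω3, one_pow]) hne
    simp only [Finset.card_empty, Nat.cast_zero]
    linear_combination -this

theorem sum_addChar_mul_pow_three {g : Fˣ} (hg : ∀ x : Fˣ, x ∈ Subgroup.zpowers g)
    {χ : MulChar F ℂ} (hχ : orderOf χ = 3) {m : ℕ} (hm : m ≠ 0) 
    (hcard : Fintype.card F = 3 * m + 1) {ψ : AddChar F ℂ} (hψ : ψ.IsPrimitive) (h : Fˣ) :
    ∑ y : F, ψ (h * y ^ 3) = χ⁻¹ h * gaussSum χ ψ + χ h * gaussSum χ⁻¹ ψ := by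
  classical
  have h1 : ∑ y : F, ψ (h * y ^ 3) = ∑ x : F, (1 + χ x + χ⁻¹ x) * ψ (h * x) := by
    rw [← Finset.sum_fiberwise (s := Finset.univ) (g := fun y : F => y ^ 3)]
    refine Finset.sum_congr rfl fun x _ => ?_
    rw [← card_pow_three_eq hg hχ hm hcard x, ← nsmul_eq_mul, ← Finset.sum_const]
    refine Finset.sum_congr rfl fun y hy => ?_
    rw [(Finset.mem_filter.mp hy).2]
  have h2 : ∑ x : F, ψ (h * x) = 0 := by
    simpa [AddChar.mulShift_apply] using AddChar.sum_eq_zero_of_ne_one (hψ h.ne_zero)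
  have h3 := gaussSum_mulShift_eq χ ψ h
  have h4 := gaussSum_mulShift_eq χ⁻¹ ψ h
  rw [inv_inv] at h4
  rw [← h3, ← h4, h1]
  simp only [add_mul, Finset.sum_add_distrib, one_mul, h2, zero_add, gaussSum,
    AddChar.mulShift_apply]

theorem gaussSum_mul_gaussSum_inv_of_orderOf_eq_three
    {χ : MulChar F ℂ} (hχ : orderOf χ = 3) {ψ : AddChar F ℂ} (hψ : ψ.IsPrimitive) :
    gaussSum χ ψ * gaussSum χ⁻¹ ψ = Fintype.card F := by
  have hχ1 := ne_one_of_orderOf_eq_three hχ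
  have h := gaussSum_mul_gaussSum_pow_orderOf_sub_one hχ1 hψ
  have hneg : χ (-1) = 1 := by
    have : χ (-1) = (χ ^ 3) (-1) := by
      rw [MulChar.pow_apply' χ three_ne_zero, ← map_pow]
      norm_num
    rw [this, ← hχ, pow_orderOf_eq_one]
    exact MulChar.one_apply isUnit_one.neg
  rw [hχ, hneg, one_mul] at h
  rw [inv_eq_sq_of_orderOf_eq_three hχ]
  exact h

theorem gaussSum_pow_three {χ : MulChar F ℂ} (hχ : orderOf χ = 3)
    {ψ : AddChar F ℂ} (hψ : ψ.IsPrimitive) :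
    gaussSum χ ψ ^ 3 = Fintype.card F * jacobiSum χ χ := by
  have hinv : χ * χ = χ⁻¹ := by rw [inv_eq_sq_of_orderOf_eq_three hχ, pow_two]
  have hχ1 : χ * χ ≠ 1 := by
    rw [hinv, inv_ne_one]
    exact ne_one_of_orderOf_eq_three hχ
  have h1 := jacobiSum_mul_nontrivial hχ1 ψ
  have h2 := gaussSum_mul_gaussSum_inv_of_orderOf_eq_three hχ hψ
  rw [hinv] at h1
  rw [← h2]
  linear_combination -gaussSum χ ψ * h1

theorem MulChar.star_jacobiSum (χ : MulChar F ℂ) : star (jacobiSum χ χ) = jacobiSum χ⁻¹ χ⁻¹ := by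
  simp only [jacobiSum, star_sum, star_mul', MulChar.star_apply']

/-- Write the cubic Jacobi sum over `F` as `u + v ω`; the same `u` and `v` express the reduction
of the sum modulo a prime above the characteristic. -/
theorem exists_jacobiSum_eq_and_sum_pow_eq {g : Fˣ} (hg : ∀ x : Fˣ, x ∈ Subgroup.zpowers g)
    {χ : MulChar F ℂ} (hχ : orderOf χ = 3) {m : ℕ} (hm : m ≠ 0)
    (hcard : Fintype.card F = 3 * m + 1) :
    ∃ u v : ℤ, jacobiSum χ χ = u + v * χ g ∧
      ∑ x : F, x ^ m * (1 - x) ^ m = u + v * (g : F) ^ m ∧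
      ∑ x : F, x ^ (2 * m) * (1 - x) ^ (2 * m) = u + v * ((g : F) ^ m) ^ 2 := by
  classical
  have hω := MulChar.apply_generator_sq_add_self_add_one hg hχ
  have hζ := Units.generator_pow_sq_add_self_add_one hg hm hcard
  have hlog : ∀ x : F, ∃ j : ℕ, x ≠ 0 → x = (g : F) ^ j := by
    intro x
    by_cases hx : x = 0
    · exact ⟨0, fun h => absurd hx h⟩
    · obtain ⟨j, hj⟩ := Units.exists_pow_eq_of_forall_mem_zpowers hg hx
      exact ⟨j, fun _ => hj⟩
  choose j hj using hlog
  obtain ⟨u, v, huv⟩ := exists_int_forall_sum_pow_eq (Finset.univ \ {(0 : F), 1})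
    fun x : F => j x + j (1 - x)
  have hne : ∀ x : F, x ∈ (Finset.univ \ {0, 1} : Finset F) → x ≠ 0 ∧ 1 - x ≠ 0 := by
    intro x hx
    simp only [Finset.mem_sdiff, Finset.mem_univ, Finset.mem_insert, Finset.mem_singleton,
      true_and, not_or] at hx
    exact ⟨hx.1, sub_ne_zero.mpr (Ne.symm hx.2)⟩
  have hF : ∀ i : ℕ, i ≠ 0 → ∑ x : F, x ^ i * (1 - x) ^ i =
      ∑ x ∈ Finset.univ \ {(0 : F), 1}, ((g : F) ^ i) ^ (j x + j (1 - x)) := by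
    intro i hi
    rw [← Finset.sum_sdiff (Finset.subset_univ {(0 : F), 1})]
    have h0 : ∑ x ∈ ({0, 1} : Finset F), x ^ i * (1 - x) ^ i = 0 := by simp [hi]
    rw [h0, add_zero]
    refine Finset.sum_congr rfl fun x hx => ?_
    obtain ⟨h1, h2⟩ := hne x hx
    rw [pow_add, pow_right_comm, pow_right_comm (g : F) i, ← hj x h1, ← hj (1 - x) h2]
  refine ⟨u, v, ?_, ?_, ?_⟩
  · rw [← huv ℂ _ hω, jacobiSum_eq_sum_sdiff]
    refine Finset.sum_congr rfl fun x hx => ?_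
    obtain ⟨h1, h2⟩ := hne x hx
    rw [pow_add, ← map_pow, ← map_pow, ← hj x h1, ← hj (1 - x) h2]
  · rw [hF m hm, huv F _ hζ]
  · rw [hF (2 * m) (by omega), mul_comm 2 m, pow_mul, huv F]
    linear_combination (((g : F) ^ m) ^ 2 - (g : F) ^ m + 1) * hζ

theorem exists_jacobiSum_eq_neg_one_add_three_mul {g : Fˣ}
    (hg : ∀ x : Fˣ, x ∈ Subgroup.zpowers g) {χ : MulChar F ℂ} (hχ : orderOf χ = 3) {m : ℕ}
    (hcard : Fintype.card F = 3 * m + 1) :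
    ∃ a b : ℤ, jacobiSum χ χ = -1 + 3 * (a + b * χ g) := by
  have hω := MulChar.apply_generator_sq_add_self_add_one hg hχ
  have hprim : IsPrimitiveRoot (χ g) 3 := by
    have h : orderOf (χ g) = 3 := orderOf_eq_prime (by linear_combination (χ g - 1) * hω) (by
      intro h
      rw [h] at hω
      norm_num at hω)
    exact h ▸ IsPrimitiveRoot.orderOf _
  have h3 : χ ^ 3 = 1 := hχ ▸ pow_orderOf_eq_one χ
  obtain ⟨z, hz, hJ⟩ := exists_jacobiSum_eq_neg_one_add (by norm_num) h3 h3
    ⟨m, by omega⟩ hprim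
  obtain ⟨a, b, rfl⟩ := exists_int_eq_add_mul_of_mem_adjoin hω hz
  refine ⟨b, b - a, ?_⟩
  rw [hJ]
  push_cast
  linear_combination (a + b * χ g - 3 * b) * hω

theorem exists_jacobiSum_add_jacobiSum_inv_eq {p k : ℕ} [Fact p.Prime] [CharP F p] {g : Fˣ}
    (hg : ∀ x : Fˣ, x ∈ Subgroup.zpowers g) {χ : MulChar F ℂ} (hχ : orderOf χ = 3) {m : ℕ}
    (hm : m ≠ 0) (hcard : Fintype.card F = 3 * m + 1) (hpk : 3 * m + 1 = p ^ k) :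
    ∃ a b : ℤ, jacobiSum χ χ + jacobiSum χ⁻¹ χ⁻¹ = a ∧ 4 * (p : ℤ) ^ k = a ^ 2 + 27 * b ^ 2 ∧
      a % 3 = 1 ∧ (p % 3 = 1 → ¬ (p : ℤ) ∣ a) := by
  have hω := MulChar.apply_generator_sq_add_self_add_one hg hχ
  have hζ := Units.generator_pow_sq_add_self_add_one hg hm hcard
  have hstar : star (χ g) = χ g ^ 2 := by
    rw [MulChar.star_apply', inv_eq_sq_of_orderOf_eq_three hχ, MulChar.pow_apply_coe]
  obtain ⟨u, v, hJ, h1, h2⟩ := exists_jacobiSum_eq_and_sum_pow_eq hg hχ hm hcard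
  obtain ⟨a, b, hJ'⟩ := exists_jacobiSum_eq_neg_one_add_three_mul hg hχ hcard
  have hS := congrArg star hJ
  have hS' := congrArg star hJ'
  simp only [MulChar.star_jacobiSum, star_add, star_neg, star_mul', star_one, star_intCast,
    star_ofNat, hstar] at hS hS'
  have hsum : jacobiSum χ χ + jacobiSum χ⁻¹ χ⁻¹ = (2 * u - v : ℤ) := by
    rw [hJ, hS]; push_cast; linear_combination (v : ℂ) * hω
  have hsum' : jacobiSum χ χ + jacobiSum χ⁻¹ χ⁻¹ = (-2 + 6 * a - 3 * b : ℤ) := by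
    rw [hJ', hS']; push_cast; linear_combination (3 * b : ℂ) * hω
  have heq : 2 * u - v = -2 + 6 * a - 3 * b := by exact_mod_cast hsum.symm.trans hsum'
  have hnorm : jacobiSum χ χ * jacobiSum χ⁻¹ χ⁻¹ = (p : ℂ) ^ k := by
    have hne := ne_one_of_orderOf_eq_three hχ
    have hne2 : χ * χ ≠ 1 := by
      rw [← pow_two, ← inv_eq_sq_of_orderOf_eq_three hχ, inv_ne_one]
      exact hne
    rw [jacobiSum_mul_jacobiSum_inv _ hne hne hne2, hcard, hpk, Nat.cast_pow]
    rw [ringChar.eq_zero, ringChar.eq F p]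
    exact (Fact.out : p.Prime).ne_zero.symm
  refine ⟨2 * u - v, b, hsum, ?_, by omega, fun hp hdvd => ?_⟩
  · rw [heq]
    have : (4 * (p : ℂ) ^ k) = ((-2 + 6 * a - 3 * b : ℤ) : ℂ) ^ 2 + 27 * (b : ℂ) ^ 2 := by
      rw [← hnorm, hJ', hS']
      push_cast
      linear_combination (36 * b * (a + b * (χ g - 1)) - 12 * b : ℂ) * hω
    exact_mod_cast this
  · rw [FiniteField.sum_pow_mul_one_sub_pow_eq_zero hm hcard] at h1
    rw [FiniteField.sum_pow_two_mul_mul_one_sub_pow_two_mul hm hcard] at h2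
    have h0 : ((2 * u - v : ℤ) : F) = 0 := (CharP.intCast_eq_zero_iff F p _).mpr hdvd
    push_cast at h0
    have hC : (-1 : F) ^ m * ((2 * m).choose m : F) = 0 := by
      linear_combination -h1 - h2 - h0 - v * hζ
    rcases mul_eq_zero.mp hC with h | h
    · exact pow_ne_zero m (neg_ne_zero.mpr one_ne_zero) h
    · exact Nat.not_dvd_choose_two_mul_of_three_mul_add_one_eq_pow hp k m hpk
        ((CharP.cast_eq_zero_iff F p _).mp h)

theorem AddChar.isPrimitive_of_eq_exp_trace {p : ℕ} [Fact p.Prime] [Algebra (ZMod p) F]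
    {ψ : AddChar F ℂ}
    (hψ : ∀ x : F, ψ x = Complex.exp (2 * (Real.pi : ℂ) * Complex.I
      * ((Algebra.trace (ZMod p) F x).val : ℂ) / (p : ℂ))) : ψ.IsPrimitive := by
  apply AddChar.IsPrimitive.of_ne_one
  obtain ⟨x, hx⟩ := Algebra.trace_surjective (ZMod p) F 1
  intro h
  have hp : p.Prime := Fact.out
  have h1 := hψ x
  have : Fact (1 < p) := ⟨hp.one_lt⟩
  rw [h, AddChar.one_apply, hx, ZMod.val_one, Nat.cast_one, mul_one] at h1
  exact (Complex.isPrimitiveRoot_exp p hp.ne_zero).ne_one hp.one_lt h1.symm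

end FiniteField

/-- With `S_h = ∑_{y ∈ F_q} ψ(h·y³)`, the values `S_g`, `S_{g²}`, `S_{g³}`
are the three roots of `x³ - 3qx - qc = 0`; i.e.
`x³ - 3qx - qc = (x - S_g)(x - S_{g²})(x - S_{g³})` as polynomials over `ℂ`. -/
theorem S_roots_of_cubic
    (p k q : ℕ) [Fact p.Prime] (hk : 0 < k) (hq : q = p ^ k) (hq3 : q % 3 = 1)
    (F : Type) [Field F] [Fintype F] [Algebra (ZMod p) F] (hF : Fintype.card F = q)
    (g : Fˣ) (hg : ∀ x : Fˣ, x ∈ Subgroup.zpowers g)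
    (ψ : AddChar F ℂ)
    (hψ : ∀ x : F, ψ x = Complex.exp (2 * (Real.pi : ℂ) * Complex.I
      * ((Algebra.trace (ZMod p) F x).val : ℂ) / (p : ℂ)))
    (c d : ℤ) (h4q : 4 * (q : ℤ) = c ^ 2 + 27 * d ^ 2) (hc3 : c % 3 = 1)
    (hcp : p % 3 = 1 → IsCoprime c (p : ℤ))
    (S : F → ℂ) (hS : ∀ h : F, S h = ∑ y : F, ψ (h * y ^ 3)) :
    (Polynomial.X ^ 3 - Polynomial.C (3 * (q : ℂ)) * Polynomial.X
        - Polynomial.C ((q : ℂ) * (c : ℂ)) : Polynomial ℂ)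
      = (Polynomial.X - Polynomial.C (S ((g : F))))
          * (Polynomial.X - Polynomial.C (S ((g : F) ^ 2)))
          * (Polynomial.X - Polynomial.C (S ((g : F) ^ 3))) := by
  obtain ⟨m, hm⟩ : ∃ m, q = 3 * m + 1 := ⟨q / 3, by omega⟩
  have hcard : Fintype.card F = 3 * m + 1 := hF.trans hm
  have hpp : p.Prime := Fact.out
  have hm0 : m ≠ 0 := by
    rintro rfl
    have := Fintype.one_lt_card (α := F)
    omega
  have : CharP F p := charP_of_injective_algebraMap' (ZMod p) p
  obtain ⟨χ, hχ⟩ := MulChar.exists_mulChar_orderOf F (n := 3) ⟨m, by omega⟩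
    (Complex.isPrimitiveRoot_exp 3 three_ne_zero)
  have hω := MulChar.apply_generator_sq_add_self_add_one hg hχ
  have hψ' := AddChar.isPrimitive_of_eq_exp_trace hψ
  obtain ⟨a, b, hJ, h4, ha3, hpa⟩ :=
    exists_jacobiSum_add_jacobiSum_inv_eq hg hχ hm0 hcard (hm ▸ hq)
  have hca : c = a := by
    rw [hq, Nat.cast_pow] at h4q
    have hp3 : p % 3 ≠ 0 := by
      intro h
      have hk' : p ^ k % 3 = 0 := by rw [Nat.pow_mod, h, zero_pow hk.ne', Nat.zero_mod]
      omega
    rcases (by omega : p % 3 = 1 ∨ p % 3 = 2) with hp1 | hp2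
    · refine Int.eq_of_four_mul_pow_eq_of_not_dvd (by omega) h4q h4 hc3 ha3 (fun h => ?_)
        (hpa hp1)
      exact (Nat.prime_iff_prime_int.mp hpp).not_isUnit ((hcp hp1).isUnit_of_dvd' h dvd_rfl)
    · exact Int.eq_of_four_mul_pow_eq_of_mod_three_eq_two hp2 h4q h4 hc3 ha3
  have hS' : ∀ i : ℕ, S ((g : F) ^ i) =
      (χ g ^ 2) ^ i * gaussSum χ ψ + χ g ^ i * gaussSum χ⁻¹ ψ := by
    intro i
    have := sum_addChar_mul_pow_three hg hχ hm0 hcard hψ' (g ^ i)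
    rw [hS, ← Units.val_pow_eq_pow_val, this, inv_eq_sq_of_orderOf_eq_three hχ,
      MulChar.pow_apply_coe, Units.val_pow_eq_pow_val, map_pow, pow_right_comm]
  have hS1 := hS' 1
  rw [pow_one, pow_one, pow_one] at hS1
  have hG := gaussSum_mul_gaussSum_inv_of_orderOf_eq_three hχ hψ'
  have hχ' : orderOf χ⁻¹ = 3 := by rw [orderOf_inv, hχ]
  have hG1 := gaussSum_pow_three hχ hψ'
  have hG2 := gaussSum_pow_three hχ' hψ'
  rw [hF] at hG hG1 hG2
  have hω3 : χ g ^ 3 = 1 := by linear_combination (χ g - 1) * hω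
  have hω4 : χ g ^ 4 = χ g := by linear_combination χ g * hω3
  have hω6 : χ g ^ 6 = 1 := by linear_combination (χ g ^ 3 + 1) * hω3
  rw [hS1, hS' 2, hS' 3, ← pow_mul, ← pow_mul, hω3, hω4, hω6, hca, ← hJ, mul_add, ← hG1, ← hG2,
    ← hG]
  generalize gaussSum χ ψ = G at *
  generalize gaussSum χ⁻¹ ψ = H at *
  generalize χ g = ω at *
  have hC := congrArg Polynomial.C hω
  simp only [map_add, map_mul, map_pow, map_one, map_ofNat, map_zero] at hC ⊢
  generalize Polynomial.C G = G at *
  generalize Polynomial.C H = H at *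
  generalize Polynomial.C ω = W at *
  linear_combination ((G + H) * Polynomial.X ^ 2
    - ((W - 1) * (G ^ 2 + H ^ 2) + (W ^ 2 - W + 1) * (G * H) + (G + H) ^ 2) * Polynomial.X
    + ((W - 1) * (G ^ 2 + H ^ 2) + (W ^ 2 - W + 1) * (G * H)) * (G + H)) * hC
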